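/- arXiv:math/0109140 — 5 statements merged into one kernel-verified Lean document; each statement's English description precedes it below -/
import Mathlib

section
/- Weyl type formula for hook shapes: for every 0 ≤ i ≤ N−1, every integer k ≥ 0 and every u ∈ ℂ: [0,1,…,i−1,i+1,…,N−1,k](u) = −H^{(i)}_k(u + i/2)·[0,1,…,N−1](u), where [c_1,…,c_N](u) = det(w_j(u + c_r))_{1≤j,r≤N}. -/
attribute [local instance 10] Classical.propDecidable

noncomputable section

open Finset

variable {K : Type*} [CommRing K]

/-- `Y_a(u)` as a unit of `K`, with `Y_0(u) = 1`, where
`Y_a(u) = Q_a(u - d_a) Q_a(u + d_a)⁻¹`, `d_a = 1/2` for `a < n` and `d_n = 1`. -/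
def Yq (n : ℕ) (Q : ℕ → ℂ → Kˣ) (a : ℕ) (u : ℂ) : Kˣ :=
  if a = 0 then 1
  else Q a (u - (if a = n then 1 else 2⁻¹)) * (Q a (u + (if a = n then 1 else 2⁻¹)))⁻¹

/-- `z_i(u)` for `i = 1,…,2n`, where `i ≤ n` encodes the letter `i` of the alphabet
`J = {1 ≺ ⋯ ≺ n ≺ n̄ ≺ ⋯ ≺ 1̄}`, and `i > n` encodes the letter `\overline{2n+1-i}`. -/
def zq (n : ℕ) (Q : ℕ → ℂ → Kˣ) (i : ℕ) (u : ℂ) : Kˣ :=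
  if i ≤ n then
    Yq n Q i (u + (i : ℂ) / 2) * (Yq n Q (i - 1) (u + ((i : ℂ) + 1) / 2))⁻¹
  else
    Yq n Q (2 * n - i) (u + ((i : ℂ) + 2) / 2) *
      (Yq n Q (2 * n + 1 - i) (u + ((i : ℂ) + 3) / 2))⁻¹

/-- the common value `x_{n+1}(u) = -x_{n+2}(u)
  = Q_n(u+n/2) Q_n(u+(n+4)/2) Q_n(u+(n+2)/2)⁻²`. -/
def xqmid (n : ℕ) (Q : ℕ → ℂ → Kˣ) (u : ℂ) : K :=
  (Q n (u + (n : ℂ) / 2) : K) * (Q n (u + ((n : ℂ) + 4) / 2) : K) *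
    (((Q n (u + ((n : ℂ) + 2) / 2))⁻¹ : Kˣ) : K) ^ 2

/-- `x_i(u)` for `i = 1,…,N = 2n+2`. -/
def xq (n : ℕ) (Q : ℕ → ℂ → Kˣ) (i : ℕ) (u : ℂ) : K :=
  if i ≤ n then zq n Q i u
  else if i = n + 1 then xqmid n Q u
  else if i = n + 2 then -xqmid n Q u
  else zq n Q (i - 2) u

/-- admissibility of a column tableau: whenever `i_k = c` and `i_l = \bar c`
for some `1 ≤ c ≤ n`, one has `n + k - l ≥ c` (letters encoded as in `zq`,
positions `0`-based, which does not change the difference `k - l`). -/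
def AdmQ (n : ℕ) {a : ℕ} (t : Fin a → Fin (2 * n)) : Prop :=
  ∀ k l : Fin a, ((t k : ℕ) + 1 ≤ n) → ((t l : ℕ) + 1 = 2 * n + 1 - ((t k : ℕ) + 1)) →
    (((t k : ℕ) + 1 : ℤ)) ≤ (n : ℤ) + (k : ℕ) - (l : ℕ)

/-- the column tableau sum: `tabSumQ n Q a v = T^{(a)}_1(v)` for `0 ≤ a ≤ n`, i.e.
`T^{(a)}_1(u + 1/2) = ∑ z_{i_1}(u + (a-1)/2) ⋯ z_{i_a}(u - (a-1)/2)` over strictly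
increasing admissible tableaux. -/
def tabSumQ (n : ℕ) (Q : ℕ → ℂ → Kˣ) (a : ℕ) (v : ℂ) : K :=
  ∑ t ∈ univ.filter (fun t : Fin a → Fin (2 * n) => StrictMono t ∧ AdmQ n t),
    ∏ k : Fin a,
      (zq n Q ((t k : ℕ) + 1) (v + ((a : ℂ) - 2 * (((k : ℕ) : ℂ) + 1)) / 2) : K)

/-- `T^{(a)}_1(v)` for all `a ∈ ℤ`: the fundamental `q`-characters for `1 ≤ a ≤ n`,
extended by `T^{(0)}_1 = 1`, `T^{(a)}_1 = 0` for `a < 0`, and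
`T^{(a)}_1(u) + T^{(N-a)}_1(u) = 0`. -/
def T1q (n : ℕ) (Q : ℕ → ℂ → Kˣ) (a : ℤ) (v : ℂ) : K :=
  if a < 0 then 0
  else if a ≤ (n : ℤ) then tabSumQ n Q a.toNat v
  else if a = (n : ℤ) + 1 then 0
  else if a ≤ 2 * (n : ℤ) + 2 then -tabSumQ n Q (2 * (n : ℤ) + 2 - a).toNat v
  else 0

/-- left-to-right composition of a list of difference operators. -/
def opProd (l : List ((ℂ → K) → (ℂ → K))) : (ℂ → K) → (ℂ → K) :=
  l.foldr (· ∘ ·) id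

/-- the operator `L(u) = (M_{x_1(⋅+n)} - D)(M_{x_2(⋅+n-1)} - D) ⋯ (M_{x_N(⋅+n+1-N)} - D)`,
where `D` is the shift `(Df)(u) = f(u+1)` and `M_g` is multiplication by `g`. -/
def Lq (n : ℕ) (Q : ℕ → ℂ → Kˣ) : (ℂ → K) → (ℂ → K) :=
  opProd ((List.range (2 * n + 2)).map fun j =>
    fun f u => xq n Q (j + 1) (u + (n : ℂ) - (j : ℂ)) * f u - f (u + 1))

/-- `ε_i = -1` for `i = n+1, n+2` and `= 1` otherwise. -/
def epsq (n : ℕ) (i : ℕ) : K := if i = n + 1 ∨ i = n + 2 then -1 else 1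

/-- `L_j`, the left-to-right composition over `i = N+1-j, …, N` of the operators
`D - ε_i M_{x_i(⋅+n+1-i)}`. -/
def Ljq (n : ℕ) (Q : ℕ → ℂ → Kˣ) (j : ℕ) : (ℂ → K) → (ℂ → K) :=
  opProd ((List.range j).map fun r =>
    fun f u => f (u + 1) -
      epsq n (2 * n + 3 - j + r) * xq n Q (2 * n + 3 - j + r)
        (u + (n : ℂ) + 1 - ((2 * n + 3 - j + r : ℕ) : ℂ)) * f u)

/-- the Casorati determinant `det_{1 ≤ r,s ≤ j} (w_r(u + s - 1))`
(for a family `w` indexed by `1, 2, …`). -/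
def casq (w : ℕ → ℂ → K) (j : ℕ) (u : ℂ) : K :=
  Matrix.det (Matrix.of fun r s : Fin j => w ((r : ℕ) + 1) (u + ((s : ℕ) : ℂ)))

/-- `ξ^{(a)}_m(u)`: the determinant of the `N × N` matrix whose columns are
`(w_j(u+c))_j` for `c` running over `(0, 1, …, a-1, a+m, a+m+1, …, N+m-1)`. -/
def xiq (n : ℕ) (w : ℕ → ℂ → K) (a m : ℕ) (u : ℂ) : K :=
  Matrix.det (Matrix.of fun j r : Fin (2 * n + 2) =>
    w ((j : ℕ) + 1) (u + ((if (r : ℕ) < a then (r : ℕ) else (r : ℕ) + m : ℕ) : ℂ)))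

/-- `H^{(i)}_k`, defined by `H^{(i)}_0(u) = δ_{i,0}` and the recursion
`H^{(i)}_{k+1}(u+i/2) = -T^{(i)}_1(u+i/2) H^{(N-1)}_k(u+(N+1)/2) - H^{(i-1)}_k(u+(i+1)/2)`,
with the convention `H^{(-1)}_k = 0`. -/
def Hq (n : ℕ) (Q : ℕ → ℂ → Kˣ) : ℕ → ℕ → ℂ → K
  | i, 0 => fun _ => if i = 0 then 1 else 0
  | i, k + 1 => fun v =>
      -T1q n Q i v * Hq n Q (2 * n + 1) k (v + (2 * (n : ℂ) + 3 - (i : ℂ)) / 2) -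
        if i = 0 then 0 else Hq n Q (i - 1) k (v + 2⁻¹)

/-- Moving column `i` of a square matrix to the last place and replacing it there by the linear
combination of all columns with coefficients `c` multiplies the determinant by
`(-1) ^ (m - i) * c i`. -/
theorem det_cycleIcc_updateCol_sum {m : ℕ} (A : Matrix (Fin (m + 1)) (Fin (m + 1)) K)
    (c : Fin (m + 1) → K) (i : Fin (m + 1)) :
    ((A.updateCol i fun j => ∑ s, c s • A j s).submatrix id
        (Fin.cycleIcc i (Fin.last m))).det = (-1) ^ (m - (i : ℕ)) * c i * A.det := by
  rw [Matrix.det_permute', Matrix.det_updateCol_sum, Fin.sign_cycleIcc_of_le (Fin.le_last i)]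
  simp [mul_assoc]

/-- A solution of the difference equation is expanded in its first `N` shifts, with coefficients
`(-1)^i H^{(i)}_k(u+i/2)`. -/
theorem shift_eq_sum_Hq (n : ℕ) (Q : ℕ → ℂ → Kˣ) (f : ℂ → K)
    (hf : ∀ u : ℂ, f (u + ((2 * n + 2 : ℕ) : ℂ)) =
      ∑ i ∈ range (2 * n + 2), (-1 : K) ^ i * T1q n Q i (u + (i : ℂ) / 2) * f (u + (i : ℂ)))
    (k : ℕ) (u : ℂ) :
    f (u + (k : ℂ)) =
      ∑ i ∈ range (2 * n + 2), (-1 : K) ^ i * Hq n Q i k (u + (i : ℂ) / 2) * f (u + (i : ℂ)) := by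
  induction k generalizing u with
  | zero => simp [Hq]
  | succ k ih =>
    have hterm (i : ℕ) :
        (-1 : K) ^ i * Hq n Q i (k + 1) (u + (i : ℂ) / 2) * f (u + (i : ℂ)) =
          -Hq n Q (2 * n + 1) k (u + (2 * (n : ℂ) + 3) / 2) *
              ((-1 : K) ^ i * T1q n Q i (u + (i : ℂ) / 2) * f (u + (i : ℂ))) -
            (-1 : K) ^ i * (if i = 0 then 0 else Hq n Q (i - 1) k (u + (i : ℂ) / 2 + 2⁻¹)) *
              f (u + (i : ℂ)) := by
      rw [Hq]
      beta_reduce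
      rw [show u + (i : ℂ) / 2 + (2 * (n : ℂ) + 3 - (i : ℂ)) / 2 =
        u + (2 * (n : ℂ) + 3) / 2 by ring]
      ring
    have hshift (i : ℕ) :
        (-1 : K) ^ (i + 1) * (if i + 1 = 0 then 0 else
              Hq n Q (i + 1 - 1) k (u + ((i + 1 : ℕ) : ℂ) / 2 + 2⁻¹)) *
            f (u + ((i + 1 : ℕ) : ℂ)) =
          -((-1 : K) ^ i * Hq n Q i k (u + 1 + (i : ℂ) / 2) * f (u + 1 + (i : ℂ))) := by
      rw [if_neg i.succ_ne_zero, Nat.add_sub_cancel,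
        show u + ((i + 1 : ℕ) : ℂ) / 2 + 2⁻¹ = u + 1 + (i : ℂ) / 2 by push_cast; ring,
        show u + ((i + 1 : ℕ) : ℂ) = u + 1 + (i : ℂ) by push_cast; ring]
      ring
    have htop : u + 1 + ((2 * n + 1 : ℕ) : ℂ) / 2 = u + (2 * (n : ℂ) + 3) / 2 := by
      push_cast; ring
    have hN : u + 1 + ((2 * n + 1 : ℕ) : ℂ) = u + ((2 * n + 2 : ℕ) : ℂ) := by
      push_cast; ring
    have hodd : (-1 : K) ^ (2 * n + 1) = -1 := Odd.neg_one_pow ⟨n, rfl⟩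
    rw [sum_congr rfl fun i _ => hterm i, sum_sub_distrib, ← mul_sum, ← hf,
      sum_range_succ' _ (2 * n + 1), sum_congr rfl fun i _ => hshift i,
      show u + ((k + 1 : ℕ) : ℂ) = u + 1 + (k : ℂ) by push_cast; ring, ih, sum_range_succ, htop,
      hN, hodd, sum_neg_distrib, if_pos rfl]
    ring

/-- Proposition 3.1 (Weyl type formula for hook shapes): if `w_1, …, w_N` solve
`w(u+N) = ∑_{i=0}^{N-1} (-1)^i T^{(i)}_1(u+i/2) w(u+i)`, then for `0 ≤ i ≤ N-1` and `k ≥ 0`,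
`[0,1,…,i-1,i+1,…,N-1,k](u) = -H^{(i)}_k(u+i/2) ⋅ [0,1,…,N-1](u)`. -/
theorem statement9 {K : Type*} [CommRing K] (n : ℕ) (hn : 2 ≤ n) (Q : ℕ → ℂ → Kˣ)
    (w : Fin (2 * n + 2) → ℂ → K)
    (hw : ∀ (j : Fin (2 * n + 2)) (u : ℂ),
      w j (u + ((2 * n + 2 : ℕ) : ℂ)) =
        ∑ i ∈ Finset.range (2 * n + 2),
          (-1 : K) ^ i * T1q n Q i (u + (i : ℂ) / 2) * w j (u + (i : ℂ)))
    (i k : ℕ) (hi : i ≤ 2 * n + 1) (u : ℂ) :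
    Matrix.det (Matrix.of fun j r : Fin (2 * n + 2) =>
        w j (u + ((if (r : ℕ) < i then (r : ℕ)
          else if (r : ℕ) < 2 * n + 1 then (r : ℕ) + 1 else k : ℕ) : ℂ))) =
      -Hq n Q i k (u + (i : ℂ) / 2) *
        Matrix.det (Matrix.of fun j r : Fin (2 * n + 2) => w j (u + ((r : ℕ) : ℂ))) := by
  have hcol : (Matrix.of fun j r : Fin (2 * n + 2) =>
      w j (u + ((if (r : ℕ) < i then (r : ℕ)
        else if (r : ℕ) < 2 * n + 1 then (r : ℕ) + 1 else k : ℕ) : ℂ))) =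
      ((Matrix.of fun j r : Fin (2 * n + 2) => w j (u + ((r : ℕ) : ℂ))).updateCol ⟨i, by omega⟩
        fun j => ∑ s : Fin (2 * n + 2), ((-1 : K) ^ (s : ℕ) *
          Hq n Q s k (u + ((s : ℕ) : ℂ) / 2)) • w j (u + ((s : ℕ) : ℂ))).submatrix id
        (Fin.cycleIcc ⟨i, by omega⟩ (Fin.last (2 * n + 1))) := by
    ext j r
    simp only [Matrix.of_apply, Matrix.submatrix_apply, id, Matrix.updateCol_apply]
    rcases lt_or_ge (r : ℕ) i with hr | hr
    · rw [Fin.cycleIcc_of_lt (Fin.lt_def.2 hr), if_pos hr,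
        if_neg (Fin.ne_of_val_ne hr.ne)]
    · rcases lt_or_ge (r : ℕ) (2 * n + 1) with hr' | hr'
      · have hval : ((r + 1 : Fin (2 * n + 2)) : ℕ) = r + 1 :=
          Fin.val_add_one_of_lt (Fin.lt_def.2 hr')
        rw [Fin.cycleIcc_of_ge_of_lt (Fin.le_def.2 hr) (Fin.lt_def.2 hr'), if_neg hr.not_gt,
          if_pos hr', if_neg (Fin.ne_of_val_ne (by rw [hval]; exact (Nat.lt_succ_of_le hr).ne')),
          hval]
      · obtain rfl : r = Fin.last (2 * n + 1) := Fin.ext (by simp; omega)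
        rw [Fin.cycleIcc_of_last (Fin.le_last _), if_neg hr.not_gt, if_neg hr'.not_gt, if_pos rfl,
          shift_eq_sum_Hq n Q (w j) (hw j) k u, ← Fin.sum_univ_eq_sum_range
            (fun s => (-1 : K) ^ s * Hq n Q s k (u + (s : ℂ) / 2) * w j (u + (s : ℂ)))]
        simp only [smul_eq_mul]
  have hsign : (-1 : K) ^ (2 * n + 1 - i) * (-1 : K) ^ i = -1 := by
    rw [← pow_add, Nat.sub_add_cancel hi, Odd.neg_one_pow ⟨n, rfl⟩]
  rw [hcol]
  refine (det_cycleIcc_updateCol_sum (Matrix.of fun j r : Fin (2 * n + 2) =>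
    w j (u + ((r : ℕ) : ℂ))) (fun s => (-1 : K) ^ (s : ℕ) *
      Hq n Q s k (u + ((s : ℕ) : ℂ) / 2)) ⟨i, by omega⟩).trans ?_
  rw [← mul_assoc ((-1 : K) ^ _), hsign, neg_one_mul]
end
end

section
/- Product formula for transfer matrices: define N×N matrices over K by 𝒯(u)_{j,l} = δ_{j,l+1} for 1 ≤ l ≤ N−1, 𝒯(u)_{j,N} = (−1)^{j−1} T^{(j−1)}_1(u + (j−1)/2), and ℋ_k(u)_{j,l} = (−1)^{j−1} H^{(j−1)}_{k+l−1}(u + (j−1)/2). Then for every integer k ≥ 0 and every u ∈ ℂ: 𝒯(u)·𝒯(u+1)⋯𝒯(u+k−1) = ℋ_k(u) (the empty product for k = 0 being the identity matrix). -/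
attribute [local instance 10] Classical.propDecidable

noncomputable section

open Finset

variable {K : Type*} [CommRing K]

/-- the companion-type matrix `𝒯(u)`:
`𝒯(u)_{j,l} = δ_{j,l+1}` for `1 ≤ l ≤ N-1`, and
`𝒯(u)_{j,N} = (-1)^{j-1} T^{(j-1)}_1(u + (j-1)/2)` (here `j, l` are `0`-based). -/
def Tmatq (n : ℕ) (Q : ℕ → ℂ → Kˣ) (u : ℂ) :
    Matrix (Fin (2 * n + 2)) (Fin (2 * n + 2)) K :=
  Matrix.of fun j l =>
    if (l : ℕ) < 2 * n + 1 then (if (j : ℕ) = (l : ℕ) + 1 then 1 else 0)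
    else (-1 : K) ^ (j : ℕ) * T1q n Q ((j : ℕ)) (u + ((j : ℕ) : ℂ) / 2)

/-- the matrix `ℋ_k(u)` with `ℋ_k(u)_{j,l} = (-1)^{j-1} H^{(j-1)}_{k+l-1}(u+(j-1)/2)`
(here `j, l` are `0`-based). -/
def Hmatq (n : ℕ) (Q : ℕ → ℂ → Kˣ) (k : ℕ) (u : ℂ) :
    Matrix (Fin (2 * n + 2)) (Fin (2 * n + 2)) K :=
  Matrix.of fun j l =>
    (-1 : K) ^ (j : ℕ) * Hq n Q ((j : ℕ)) (k + (l : ℕ)) (u + ((j : ℕ) : ℂ) / 2)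

/-- For `k < N` and `i < N`, one has `H^{(i)}_k = (-1)^k δ_{i,k}`. -/
theorem Hq_of_lt (n : ℕ) (Q : ℕ → ℂ → Kˣ) (k : ℕ) (hk : k < 2 * n + 2) (i : ℕ)
    (hi : i < 2 * n + 2) (v : ℂ) :
    Hq n Q i k v = if i = k then (-1) ^ k else 0 := by
  induction k generalizing i v with
  | zero => simp [Hq]
  | succ k ih =>
    have hlast : 2 * n + 1 ≠ k := by omega
    simp only [Hq]
    rw [ih (by omega) (2 * n + 1) (by omega), if_neg hlast]
    rcases i with _ | i
    · simp
    · have h := ih (by omega) i (by omega) (v + 2⁻¹)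
      simp only [Nat.add_sub_cancel, h, Nat.add_right_cancel_iff, Nat.succ_ne_zero, if_false]
      split_ifs <;> ring

theorem Hmatq_zero (n : ℕ) (Q : ℕ → ℂ → Kˣ) (u : ℂ) : Hmatq n Q 0 u = 1 := by
  ext j l
  rw [Hmatq, Matrix.of_apply, zero_add, Hq_of_lt n Q l l.isLt j j.isLt, Matrix.one_apply]
  by_cases h : j = l
  · subst h
    simp [← mul_pow]
  · simp [h, Fin.val_inj]

theorem Tmatq_mul_Hmatq (n : ℕ) (Q : ℕ → ℂ → Kˣ) (k : ℕ) (u : ℂ) :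
    Tmatq n Q u * Hmatq n Q k (u + 1) = Hmatq n Q (k + 1) u := by
  ext j m
  have hk : k + 1 + (m : ℕ) = (k + m) + 1 := by omega
  have hlast : u + 1 + ((2 * n + 1 : ℕ) : ℂ) / 2 =
      u + ((j : ℕ) : ℂ) / 2 + (2 * (n : ℂ) + 3 - ((j : ℕ) : ℂ)) / 2 := by
    push_cast; ring
  have hodd : (-1 : K) ^ (2 * n + 1) = -1 := Odd.neg_one_pow ⟨n, rfl⟩
  rw [Matrix.mul_apply, Fin.sum_univ_castSucc]
  simp only [Tmatq, Hmatq, Matrix.of_apply, Fin.val_castSucc, Fin.val_last, Fin.is_lt, if_true,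
    lt_irrefl, if_false, hk, Hq, hlast, hodd]
  obtain ⟨j, hj⟩ := j
  rcases j with _ | j
  · simp
  · rw [Finset.sum_eq_single (⟨j, by omega⟩ : Fin (2 * n + 1))]
    · have hv : u + 1 + (j : ℂ) / 2 = u + ((j + 1 : ℕ) : ℂ) / 2 + 2⁻¹ := by
        push_cast; ring
      simp only [if_true, hv, Nat.add_sub_cancel, Nat.succ_ne_zero, if_false]
      ring
    · intro b _ hb
      rw [if_neg, zero_mul]
      intro h
      exact hb (Fin.ext (by simp at h ⊢; omega))
    · simp

theorem prod_map_Tmatq (n : ℕ) (Q : ℕ → ℂ → Kˣ) (k : ℕ) (u : ℂ) :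
    ((List.range k).map fun m : ℕ => Tmatq n Q (u + (m : ℂ))).prod = Hmatq n Q k u := by
  induction k generalizing u with
  | zero => simp [Hmatq_zero]
  | succ k ih =>
    rw [List.range_succ_eq_map, List.map_cons, List.prod_cons, List.map_map,
      ← Tmatq_mul_Hmatq, ← ih (u + 1)]
    simp [Function.comp_def, add_assoc, add_comm (1 : ℂ)]

/-- Product formula for transfer matrices: `𝒯(u) 𝒯(u+1) ⋯ 𝒯(u+k-1) = ℋ_k(u)`. -/
theorem statement10 {K : Type*} [CommRing K] (n : ℕ) (hn : 2 ≤ n) (Q : ℕ → ℂ → Kˣ)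
    (k : ℕ) (u : ℂ) :
    ((List.range k).map fun m => Tmatq n Q (u + (m : ℂ))).prod = Hmatq n Q k u := by
  have hcast : (List.range k >>= fun a => pure (a : ℂ)) = (List.range k).map Nat.cast :=
    List.flatMap_pure_eq_map _ _
  rw [← prod_map_Tmatq, hcast, List.map_map, Function.comp_def]
end
end

section
/- Duality of Casorati determinants: for every 0 ≤ a ≤ N, every integer m ≥ 0 and every u ∈ ℂ: ξ^{(a)}_m(u) = (−1)^{a − n − 1 + m}·ξ^{(N−a)}_m(u + a − n − 1). -/
attribute [local instance 10] Classical.propDecidable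

noncomputable section

open Finset

variable {K : Type*} [CommRing K]

/-- The matrix with rows `(w_i(u + c_j))_j` for `i ≤ N`, where `c` runs over `0, …, N + m - 1` with
`a + k, …, a + m - 1` left out, followed by the unit row vectors at `a, …, a + k - 1`. -/
def extendedCasorati (N : ℕ) (w : ℕ → ℂ → K) (a m k : ℕ) (u : ℂ) :
    Matrix (Fin (N + k)) (Fin (N + k)) K :=
  Matrix.of fun i j =>
    if (i : ℕ) < N then
      w ((i : ℕ) + 1) (u + ((if (j : ℕ) < a + k then (j : ℕ) else (j : ℕ) + (m - k) : ℕ) : ℂ))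
    else if (j : ℕ) = a + ((i : ℕ) - N) then 1 else 0

theorem det_extendedCasorati_succ (N : ℕ) (w : ℕ → ℂ → K) (a m k : ℕ) (u : ℂ) (ha : a ≤ N)
    (hk : k < m) :
    (extendedCasorati N w a m (k + 1) u).det =
      (-1) ^ (N - a) * (extendedCasorati N w a m k u).det := by
  have key := Matrix.det_succ_row (n := N + k) (extendedCasorati N w a m (k + 1) u)
    (Fin.last (N + k))
  rw [Finset.sum_eq_single (⟨a + k, by omega⟩ : Fin (N + k + 1))] at key
  · refine key.trans ?_
    have h1 : extendedCasorati N w a m (k + 1) u (Fin.last (N + k))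
        (⟨a + k, by omega⟩ : Fin (N + k + 1)) = 1 := by
      simp [extendedCasorati]
    have h2 : (extendedCasorati N w a m (k + 1) u).submatrix (Fin.last (N + k)).succAbove
        (⟨a + k, by omega⟩ : Fin (N + k + 1)).succAbove = extendedCasorati N w a m k u := by
      ext i j
      simp only [Matrix.submatrix_apply, extendedCasorati, Matrix.of_apply, Fin.succAbove_last,
        Fin.val_castSucc, Fin.succAbove, Fin.lt_def]
      split_ifs <;> simp_all <;>
        first
        | omega
        | (rw [Nat.cast_sub hk.le]; congr 1; ring)
    have h3 : (-1 : K) ^ ((Fin.last (N + k) : ℕ) + (a + k)) = (-1) ^ (N - a) := by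
      rw [Fin.val_last, show N + k + (a + k) = (N - a) + 2 * (a + k) by omega, pow_add, pow_mul]
      simp
    rw [h1, h2]
    simp only [h3, mul_one]
  · intro j _ hj
    have : (j : ℕ) ≠ a + k := fun h => hj (Fin.ext h)
    have h1 : extendedCasorati N w a m (k + 1) u (Fin.last (N + k)) j = 0 := by
      simp [extendedCasorati, this]
    rw [h1]; simp
  · simp

theorem det_extendedCasorati (N : ℕ) (w : ℕ → ℂ → K) (a m k : ℕ) (u : ℂ) (ha : a ≤ N)
    (hk : k ≤ m) :
    (extendedCasorati N w a m k u).det =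
      ((-1) ^ (N - a)) ^ k * (extendedCasorati N w a m 0 u).det := by
  induction k with
  | zero => simp
  | succ k ih => rw [det_extendedCasorati_succ N w a m k u ha hk, ih (by omega)]; ring

/-- The square matrix whose first `N` columns are unit vectors and whose next `m` columns hold the
coefficients of the recurrence `∑ b, e b v * w (v + b) = 0` at `v = u, …, u + m - 1`. -/
def recurrenceColumns (N m : ℕ) (e : ℤ → ℂ → K) (u : ℂ) :
    Matrix (Fin (N + m)) (Fin (N + m)) K :=
  Matrix.of fun k l =>
    if (l : ℕ) < N then if k = l then 1 else 0
    else e ((k : ℤ) - ((l : ℕ) - N : ℕ)) (u + ((l : ℕ) - N : ℕ))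

theorem det_recurrenceColumns (N m : ℕ) (e : ℤ → ℂ → K) (u : ℂ)
    (hgt : ∀ b : ℤ, (N : ℤ) < b → e b = 0) (htop : e N = 1) :
    (recurrenceColumns N m e u).det = 1 := by
  rw [Matrix.det_of_isUpperTriangular]
  · refine Finset.prod_eq_one fun i _ => ?_
    simp only [recurrenceColumns, Matrix.of_apply]
    split_ifs with h
    · rfl
    · rw [show ((i : ℕ) : ℤ) - ((i : ℕ) - N : ℕ) = N by omega, htop]; rfl
  · intro k l hkl
    have hkl' : (l : ℕ) < k := hkl
    simp only [recurrenceColumns, Matrix.of_apply]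
    split_ifs with h h'
    · omega
    · rfl
    · rw [hgt _ (by omega)]; rfl

/-- A Casorati determinant with a gap of length `m` is, up to sign, the Casorati determinant without
gap times an `m × m` determinant in the coefficients of the recurrence. -/
theorem det_gap_casorati (N : ℕ) (w : ℕ → ℂ → K) (e : ℤ → ℂ → K)
    (hneg : ∀ b : ℤ, b < 0 → e b = 0) (hgt : ∀ b : ℤ, (N : ℤ) < b → e b = 0) (htop : e N = 1)
    (hrec : ∀ j : ℕ, 1 ≤ j → j ≤ N → ∀ u : ℂ,
      ∑ b ∈ range (N + 1), e b u * w j (u + b) = 0)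
    (a m : ℕ) (ha : a ≤ N) (u : ℂ) :
    Matrix.det (Matrix.of fun j r : Fin N =>
      w ((j : ℕ) + 1) (u + ((if (r : ℕ) < a then (r : ℕ) else (r : ℕ) + m : ℕ) : ℂ))) =
    ((-1) ^ (N - a)) ^ m *
      (Matrix.det (Matrix.of fun r s : Fin N => w ((r : ℕ) + 1) (u + ((s : ℕ) : ℂ))) *
        Matrix.det (Matrix.of fun j i : Fin m => e ((a : ℤ) + j - i) (u + (i : ℕ)))) := by
  set G := extendedCasorati N w a m m u with hG
  set H := recurrenceColumns N m e u with hH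
  have hprod : (G * H).submatrix finSumFinEquiv finSumFinEquiv = Matrix.fromBlocks
      (Matrix.of fun r s : Fin N => w ((r : ℕ) + 1) (u + ((s : ℕ) : ℂ))) 0
      (Matrix.of fun (r : Fin m) (s : Fin N) => G (Fin.natAdd N r) (Fin.castAdd m s))
      (Matrix.of fun j i : Fin m => e ((a : ℤ) + j - i) (u + (i : ℕ))) := by
    have hleft : ∀ (r : Fin (N + m)) (s : Fin N),
        (G * H) r (Fin.castAdd m s) = G r (Fin.castAdd m s) := by
      intro r s
      rw [Matrix.mul_apply, Finset.sum_eq_single (Fin.castAdd m s)]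
      · simp [hH, recurrenceColumns]
      · intro b _ hb
        simp [hH, recurrenceColumns, hb]
      · simp
    ext (r | r) (s | s)
    · simp only [Matrix.submatrix_apply, finSumFinEquiv_apply_left, hleft]
      simp [hG, extendedCasorati]
    · simp only [Matrix.submatrix_apply, finSumFinEquiv_apply_left, finSumFinEquiv_apply_right,
        Matrix.fromBlocks_apply₁₂, Matrix.zero_apply, Matrix.mul_apply]
      have hterm : ∀ k : Fin (N + m), G (Fin.castAdd m r) k * H k (Fin.natAdd N s) =
          (fun k : ℕ => w ((r : ℕ) + 1) (u + k) * e ((k : ℤ) - (s : ℕ)) (u + (s : ℕ))) k := by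
        intro k
        simp [hG, hH, extendedCasorati, recurrenceColumns]
      rw [Finset.sum_congr rfl fun k _ => hterm k, Fin.sum_univ_eq_sum_range
        (fun k : ℕ => w ((r : ℕ) + 1) (u + k) * e ((k : ℤ) - (s : ℕ)) (u + (s : ℕ))) (N + m)]
      rw [← hrec ((r : ℕ) + 1) (by omega) (by omega) (u + (s : ℕ))]
      have hsub : Finset.Ico (s : ℕ) (s + (N + 1)) ⊆ range (N + m) := by
        intro x; simp; omega
      rw [← Finset.sum_subset hsub, Finset.sum_Ico_eq_sum_range]
      · rw [Nat.add_sub_cancel_left]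
        refine Finset.sum_congr rfl fun b _ => ?_
        push_cast
        rw [mul_comm, add_sub_cancel_left, add_assoc]
      · intro x _ hx
        simp only [Finset.mem_Ico, not_and_or] at hx
        rcases lt_or_ge x (s : ℕ) with h | h
        · rw [hneg _ (by omega)]; simp
        · rw [hgt _ (by omega)]; simp
    · simp [hleft]
    · simp only [Matrix.submatrix_apply, finSumFinEquiv_apply_right,
        Matrix.fromBlocks_apply₂₂, Matrix.of_apply, Matrix.mul_apply]
      rw [Finset.sum_eq_single (⟨a + r, by omega⟩ : Fin (N + m))]
      · simp [hG, hH, extendedCasorati, recurrenceColumns]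
      · intro b _ hb
        have : (b : ℕ) ≠ a + r := fun h => hb (Fin.ext h)
        simp [hG, extendedCasorati, this]
      · simp
  have hdet := congrArg Matrix.det hprod
  rw [Matrix.det_submatrix_equiv_self, Matrix.det_mul, Matrix.det_fromBlocks_zero₁₂, hH,
    det_recurrenceColumns N m e u hgt htop, mul_one, hG, det_extendedCasorati N w a m m u ha le_rfl]
    at hdet
  rw [← hdet, ← mul_assoc, ← mul_pow, ← mul_pow]
  have h0 : extendedCasorati N w a m 0 u = Matrix.of fun j r : Fin N =>
      w ((j : ℕ) + 1) (u + ((if (r : ℕ) < a then (r : ℕ) else (r : ℕ) + m : ℕ) : ℂ)) := by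
    ext i j
    simp [extendedCasorati]
  rw [h0]
  simp

/-- Skew self-adjointness, up to the shift by `r`, of the operator `∑ b, s b · D ^ b`. -/
def SkewDual (r : ℕ) (s : ℤ → ℂ → K) : Prop :=
  ∀ (b : ℤ) (u : ℂ), s b u = -s (2 * r - b) (u + b - r)

theorem SkewDual.gauge {r : ℕ} {s : ℤ → ℂ → K} (hs : SkewDual r s) {c c' : ℂ → K}
    (hc : ∀ u, c u = c' (u + r)) : SkewDual r fun b u => c u * s b u * c' (u + b) := by
  intro b u
  simp only [hs b u, hc]
  push_cast
  rw [show u + (b : ℂ) - r + r = u + b by ring,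
    show u + (b : ℂ) - r + (2 * r - b) = u + r by ring]
  ring

theorem SkewDual.difference {r : ℕ} {s : ℤ → ℂ → K} (hs : SkewDual r s) :
    SkewDual (r + 1) fun b u =>
      s (b - 2) (u + 1) - s (b - 1) (u + 1) - s (b - 1) u + s b u := by
  intro b u
  have h1 := hs (b - 2) (u + 1)
  have h2 := hs (b - 1) (u + 1)
  have h3 := hs (b - 1) u
  have h4 := hs b u
  push_cast at h1 h2 h3 h4 ⊢
  simp only [h1, h2, h3, h4]
  rw [show 2 * ((r : ℤ) + 1) - b - 2 = 2 * r - b by ring,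
    show 2 * ((r : ℤ) + 1) - b - 1 = 2 * r - (b - 1) by ring,
    show 2 * ((r : ℤ) + 1) - b = 2 * r - (b - 2) by ring,
    show u + (b : ℂ) - (r + 1) + 1 = u + b - r by ring,
    show u + 1 + ((b : ℂ) - 2) - r = u + b - (r + 1) by ring,
    show u + 1 + ((b : ℂ) - 1) - r = u + b - r by ring,
    show u + ((b : ℂ) - 1) - r = u + b - (r + 1) by ring]
  ring

/-- Coefficients of `(D - p) ∘ (∑ b, e b · D ^ b) ∘ (D - q)`. -/
def wrapCoeff (p q : ℂ → K) (e : ℤ → ℂ → K) (b : ℤ) (u : ℂ) : K :=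
  e (b - 2) (u + 1) - p u * e (b - 1) u - e (b - 1) (u + 1) * q (u + b) + p u * e b u * q (u + b)

theorem exists_skewDual_wrapCoeff {r : ℕ} {s e : ℤ → ℂ → K} (hs : SkewDual r s)
    {A B P R A' B' : ℂ → Kˣ} (he : ∀ b u, e b u = A u * s b u * B (u + b))
    (hmid : ∀ u, P u * A u = B (u + r) * (R (u + r + 1))⁻¹)
    (hout : ∀ u, (P (u + 1))⁻¹ * (A' u)⁻¹ = R (u + r + 1) * (B' (u + r + 1))⁻¹) :
    ∃ s' : ℤ → ℂ → K, SkewDual (r + 1) s' ∧ ∀ b u,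
      wrapCoeff (fun u => ((P u * (P (u + 1))⁻¹ : Kˣ) : K))
        (fun u => ((R u * (R (u + 1))⁻¹ : Kˣ) : K)) e b u = A' u * s' b u * B' (u + b) := by
  have ht := (hs.gauge (c := fun u => ((P u * A u : Kˣ) : K))
    (c' := fun u => ((B u * (R (u + 1))⁻¹ : Kˣ) : K)) fun u => by rw [hmid]).difference.gauge
    (c := fun u => (((P (u + 1))⁻¹ * (A' u)⁻¹ : Kˣ) : K))
    (c' := fun u => ((R u * (B' u)⁻¹ : Kˣ) : K))
    (fun u => by rw [hout]; push_cast; rw [add_assoc])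
  refine ⟨_, ht, fun b u => ?_⟩
  simp only [wrapCoeff, he]
  push_cast
  rw [show u + 1 + ((b : ℂ) - 2) = u + b - 1 by ring, show u + 1 + ((b : ℂ) - 1) = u + b by ring,
    show u + ((b : ℂ) - 1) = u + b - 1 by ring, show u + (b : ℂ) - 1 + 1 = u + b by ring]
  have i1 := Units.mul_inv (P (u + 1))
  have i2 := Units.mul_inv (A' u)
  have i3 := Units.mul_inv (R (u + b))
  have i4 := Units.mul_inv (B' (u + b))
  have e1 : ∀ x : K, (A' u : K) * ((((P (u + 1))⁻¹ : Kˣ) : K) * (((A' u)⁻¹ : Kˣ) : K) * x *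
      ((R (u + b) : K) * (((B' (u + b))⁻¹ : Kˣ) : K))) * (B' (u + b) : K) =
      (((P (u + 1))⁻¹ : Kˣ) : K) * x * (R (u + b) : K) := by
    intro x
    linear_combination ((((P (u + 1))⁻¹ : Kˣ) : K) * x * (R (u + b) : K)) *
      (i2 * ((B' (u + b) : K) * (((B' (u + b))⁻¹ : Kˣ) : K)) + i4)
  rw [e1]
  generalize (((P (u + 1))⁻¹ : Kˣ) : K) = pi at *
  generalize (((R (u + b))⁻¹ : Kˣ) : K) = ri at *
  linear_combination
    (-(A (u + 1) : K) * s (b - 2) (u + 1) * B (u + b - 1)) * (i1 * ((R (u + b) : K) * ri) + i3)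
    + (P u : K) * pi * A u * s (b - 1) u * B (u + b - 1) * i3
    + (A (u + 1) : K) * s (b - 1) (u + 1) * B (u + b) * (R (u + b) : K)
      * (((R (u + b + 1))⁻¹ : Kˣ) : K) * i1

/-- `T = ∑ b, e b · D ^ b` is monic of degree `d`. -/
structure HasMonicCoeff (T : (ℂ → K) → (ℂ → K)) (d : ℕ) (e : ℤ → ℂ → K) : Prop where
  neg : ∀ b : ℤ, b < 0 → e b = 0
  gt : ∀ b : ℤ, (d : ℤ) < b → e b = 0
  top : e d = 1
  apply : ∀ f u, T f u = ∑ b ∈ range (d + 1), e b u * f (u + b)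

theorem HasMonicCoeff.comp_left {T : (ℂ → K) → (ℂ → K)} {d : ℕ} {e : ℤ → ℂ → K}
    (h : HasMonicCoeff T d e) (p : ℂ → K) :
    HasMonicCoeff ((fun f u => f (u + 1) - p u * f u) ∘ T) (d + 1)
      (fun b u => e (b - 1) (u + 1) - p u * e b u) where
  neg b hb := by
    funext u; simp [h.neg b hb, h.neg (b - 1) (by omega)]
  gt b hb := by
    push_cast at hb
    funext u; simp [h.gt b (by omega), h.gt (b - 1) (by omega)]
  top := by
    funext u; simp [h.gt ((d : ℤ) + 1) (by omega), h.top]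
  apply f u := by
    simp only [Function.comp, h.apply, sub_mul, Finset.sum_sub_distrib]
    rw [Finset.sum_range_succ' _ (d + 1), Finset.sum_range_succ _ (d + 1)]
    rw [h.gt ((d + 1 : ℕ) : ℤ) (by push_cast; omega), h.neg (((0 : ℕ) : ℤ) - 1) (by simp)]
    simp only [Finset.mul_sum, Pi.zero_apply, mul_zero, zero_mul, add_zero, mul_assoc]
    congr 1
    refine Finset.sum_congr rfl fun b _ => ?_
    push_cast
    rw [add_sub_cancel_right, show u + 1 + (b : ℂ) = u + (b + 1) by ring]

theorem HasMonicCoeff.comp_right {T : (ℂ → K) → (ℂ → K)} {d : ℕ} {e : ℤ → ℂ → K}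
    (h : HasMonicCoeff T d e) (q : ℂ → K) :
    HasMonicCoeff (T ∘ fun f u => f (u + 1) - q u * f u) (d + 1)
      (fun b u => e (b - 1) u - e b u * q (u + b)) where
  neg b hb := by
    funext u; simp [h.neg b hb, h.neg (b - 1) (by omega)]
  gt b hb := by
    push_cast at hb
    funext u; simp [h.gt b (by omega), h.gt (b - 1) (by omega)]
  top := by
    funext u; simp [h.gt ((d : ℤ) + 1) (by omega), h.top]
  apply f u := by
    simp only [Function.comp, h.apply, sub_mul, mul_sub, Finset.sum_sub_distrib]
    rw [Finset.sum_range_succ' _ (d + 1), Finset.sum_range_succ _ (d + 1)]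
    rw [h.gt ((d + 1 : ℕ) : ℤ) (by push_cast; omega), h.neg (((0 : ℕ) : ℤ) - 1) (by simp)]
    simp only [Pi.zero_apply, zero_mul, add_zero, mul_assoc]
    congr 1
    refine Finset.sum_congr rfl fun b _ => ?_
    push_cast
    rw [add_sub_cancel_right, show u + (b : ℂ) + 1 = u + (b + 1) by ring]

theorem HasMonicCoeff.wrap {T : (ℂ → K) → (ℂ → K)} {d : ℕ} {e : ℤ → ℂ → K}
    (h : HasMonicCoeff T d e) (p q : ℂ → K) :
    HasMonicCoeff ((fun f u => f (u + 1) - p u * f u) ∘ T ∘ fun f u => f (u + 1) - q u * f u)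
      (d + 2) (wrapCoeff p q e) := by
  have hcoeff : wrapCoeff p q e = fun b u => (e (b - 1 - 1) (u + 1) - p u * e (b - 1) u) -
      (e (b - 1) (u + 1) - p u * e b u) * q (u + b) := by
    funext b u
    rw [wrapCoeff, show b - 1 - 1 = b - 2 by ring]
    ring
  rw [hcoeff]
  exact (h.comp_left p).comp_right q

theorem hasMonicCoeff_id : HasMonicCoeff (id : (ℂ → K) → (ℂ → K)) 0 (Pi.single 0 1) where
  neg b hb := by simp [hb.ne]
  gt b hb := by simp at hb; simp [hb.ne']
  top := by simp
  apply f u := by simp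

/-- `Q_a`, extended by `Q_0 = 1`. -/
def Qext (Q : ℕ → ℂ → Kˣ) (a : ℕ) (u : ℂ) : Kˣ := if a = 0 then 1 else Q a u

/-- The half-step `d_a`. -/
def halfStep (n a : ℕ) : ℂ := if a = n then 1 else 2⁻¹

theorem Yq_eq (n : ℕ) (Q : ℕ → ℂ → Kˣ) (a : ℕ) (u : ℂ) :
    Yq n Q a u = Qext Q a (u - halfStep n a) * (Qext Q a (u + halfStep n a))⁻¹ := by
  unfold Yq Qext halfStep
  split_ifs <;> simp

/-- The unit function whose quotient by its shift is `Y_a(u + a / 2)`. -/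
def Ypot (n : ℕ) (Q : ℕ → ℂ → Kˣ) (a : ℕ) (u : ℂ) : Kˣ :=
  Qext Q a (u + a / 2 - halfStep n a) * if a = n then Qext Q a (u + a / 2) else 1

theorem Ypot_mul (n : ℕ) (Q : ℕ → ℂ → Kˣ) (a : ℕ) (u : ℂ) :
    Ypot n Q a u * Qext Q a (u + a / 2 + halfStep n a) =
      Qext Q a (u + a / 2 - halfStep n a) * Ypot n Q a (u + 1) := by
  unfold Ypot halfStep
  split_ifs
  · rw [show u + 1 + (a : ℂ) / 2 - 1 = u + a / 2 by ring,
      show u + 1 + (a : ℂ) / 2 = u + a / 2 + 1 by ring, mul_assoc]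
  · rw [show u + 1 + (a : ℂ) / 2 - 2⁻¹ = u + a / 2 + 2⁻¹ by ring]
    simp

theorem Yq_eq_Ypot (n : ℕ) (Q : ℕ → ℂ → Kˣ) (a : ℕ) (u : ℂ) :
    Yq n Q a (u + a / 2) = Ypot n Q a u * (Ypot n Q a (u + 1))⁻¹ := by
  rw [Yq_eq, ← div_eq_mul_inv, ← div_eq_mul_inv, div_eq_div_iff_mul_eq_mul, ← Ypot_mul]

/-- The coefficient `ε_i x_i(u + n + 1 - i)`. -/
def factorCoeff (n : ℕ) (Q : ℕ → ℂ → Kˣ) (i : ℕ) (u : ℂ) : K :=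
  epsq n i * xq n Q i (u + n + 1 - i)

/-- The composition of `D - ε_i M_{x_i(· + n + 1 - i)}` over `i = k + 1, …, k + l`. -/
def segmentOp (n : ℕ) (Q : ℕ → ℂ → Kˣ) (k l : ℕ) : (ℂ → K) → (ℂ → K) :=
  opProd ((List.range l).map fun r => fun f u => f (u + 1) - factorCoeff n Q (k + 1 + r) u * f u)

theorem opProd_cons_append_singleton {M : Type*} (S T : (ℂ → M) → (ℂ → M))
    (l : List ((ℂ → M) → (ℂ → M))) : opProd (S :: (l ++ [T])) = S ∘ opProd l ∘ T := by
  have h : opProd (l ++ [T]) = opProd l ∘ T := by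
    induction l with
    | nil => rfl
    | cons R l ih =>
      change R ∘ opProd (l ++ [T]) = (R ∘ opProd l) ∘ T
      rw [ih, Function.comp_assoc]
  change S ∘ opProd (l ++ [T]) = _
  rw [h]

theorem segmentOp_add_two (n : ℕ) (Q : ℕ → ℂ → Kˣ) (k l : ℕ) :
    segmentOp n Q k (l + 2) = (fun f u => f (u + 1) - factorCoeff n Q (k + 1) u * f u) ∘
      segmentOp n Q (k + 1) l ∘
      fun f u => f (u + 1) - factorCoeff n Q (k + l + 2) u * f u := by
  rw [segmentOp, List.range_succ_eq_map, List.range_succ]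
  simp only [List.map_cons, List.map_map, List.map_append, List.map_nil]
  rw [opProd_cons_append_singleton]
  simp only [segmentOp, Function.comp_def, Nat.succ_eq_add_one, add_zero]
  rw [show k + l + 2 = k + 1 + (l + 1) by omega]
  simp only [show ∀ x, k + 1 + 1 + x = k + 1 + (x + 1) by intro x; omega]

theorem Ljq_eq_segmentOp (n : ℕ) (Q : ℕ → ℂ → Kˣ) :
    Ljq n Q (2 * n + 2) = segmentOp n Q 0 (2 * n + 2) := by
  unfold Ljq segmentOp factorCoeff
  simp only [show 2 * n + 3 - (2 * n + 2) = 0 + 1 by omega]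

theorem factorCoeff_mid_mul (n : ℕ) (Q : ℕ → ℂ → Kˣ) (u : ℂ) :
    factorCoeff n Q (n + 1) u * factorCoeff n Q (n + 2) u =
      -((Q n (u + n / 2 + 2) * Q n (u + n / 2 - 1) * (Q n (u + n / 2 + 1))⁻¹ *
        (Q n (u + n / 2))⁻¹ : Kˣ) : K) := by
  simp only [factorCoeff, epsq, xq, xqmid]
  simp only [true_or, or_true, if_true, show ¬ n + 1 ≤ n by omega, show ¬ n + 2 ≤ n by omega,
    show ¬ n + 2 = n + 1 by omega, if_false]
  push_cast
  rw [show u + (n : ℂ) + 1 - (n + 1) + n / 2 = u + n / 2 by ring,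
    show u + (n : ℂ) + 1 - (n + 1) + (n + 4) / 2 = u + n / 2 + 2 by ring,
    show u + (n : ℂ) + 1 - (n + 1) + (n + 2) / 2 = u + n / 2 + 1 by ring,
    show u + (n : ℂ) + 1 - (n + 2) + n / 2 = u + n / 2 - 1 by ring,
    show u + (n : ℂ) + 1 - (n + 2) + (n + 4) / 2 = u + n / 2 + 1 by ring,
    show u + (n : ℂ) + 1 - (n + 2) + (n + 2) / 2 = u + n / 2 by ring]
  have i1 := Units.mul_inv (Q n (u + n / 2 + 1))
  have i2 := Units.mul_inv (Q n (u + n / 2))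
  generalize (((Q n (u + n / 2 + 1))⁻¹ : Kˣ) : K) = a at *
  generalize (((Q n (u + n / 2))⁻¹ : Kˣ) : K) = b at *
  linear_combination (-(Q n (u + n / 2 + 2) : K) * Q n (u + n / 2 - 1) * a * b) *
    (i1 * ((Q n (u + n / 2) : K) * b) + i2)

theorem factorCoeff_mid_add (n : ℕ) (Q : ℕ → ℂ → Kˣ) (u : ℂ) :
    factorCoeff n Q (n + 1) u + factorCoeff n Q (n + 2) (u + 1) = 0 := by
  simp only [factorCoeff, epsq, xq]
  simp only [true_or, or_true, if_true, show ¬ n + 1 ≤ n by omega, show ¬ n + 2 ≤ n by omega,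
    show ¬ n + 2 = n + 1 by omega, if_false]
  push_cast
  rw [show u + 1 + (n : ℂ) + 1 - (n + 2) = u + n + 1 - (n + 1) by ring]
  ring

theorem factorCoeff_left (n : ℕ) (Q : ℕ → ℂ → Kˣ) (k t : ℕ) (h : k + 1 + t = n) (u : ℂ) :
    factorCoeff n Q (k + 1) u =
      ((Yq n Q (k + 1) (u + (t + 1 : ℕ) + (k + 1 : ℕ) / 2) *
        (Yq n Q k (u + (t + 1 : ℕ) + (k + 2 : ℕ) / 2))⁻¹ : Kˣ) : K) := by
  simp only [factorCoeff, epsq, xq, zq]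
  rw [if_neg (by omega), if_pos (by omega), if_pos (by omega), one_mul, Nat.add_sub_cancel, ← h]
  push_cast
  rw [show u + (k + 1 + t : ℂ) + 1 - (k + 1) + (k + 1) / 2 = u + (t + 1) + (k + 1) / 2 by ring,
    show u + (k + 1 + t : ℂ) + 1 - (k + 1) + (k + 1 + 1) / 2 = u + (t + 1) + (k + 2) / 2 by ring]

theorem factorCoeff_right (n : ℕ) (Q : ℕ → ℂ → Kˣ) (k t : ℕ) (h : k + 1 + t = n) (u : ℂ) :
    factorCoeff n Q (k + (2 * t + 2) + 2) u =
      ((Yq n Q k (u + k / 2) * (Yq n Q (k + 1) (u + (k + 1 : ℕ) / 2))⁻¹ : Kˣ) : K) := by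
  simp only [factorCoeff, epsq, xq, zq]
  rw [if_neg (by omega), if_neg (by omega), if_neg (by omega), if_neg (by omega),
    if_neg (by omega), one_mul, show 2 * n - (k + (2 * t + 2) + 2 - 2) = k by omega,
    show 2 * n + 1 - (k + (2 * t + 2) + 2 - 2) = k + 1 by omega, ← h,
    show k + (2 * t + 2) + 2 - 2 = k + 2 * t + 2 by omega]
  push_cast
  rw [show u + (k + 1 + t : ℂ) + 1 - (k + (2 * t + 2) + 2) + (k + 2 * t + 2 + 2) / 2 =
      u + k / 2 by ring,
    show u + (k + 1 + t : ℂ) + 1 - (k + (2 * t + 2) + 2) + (k + 2 * t + 2 + 3) / 2 =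
      u + (k + 1) / 2 by ring]

theorem exists_segmentOp_coeff (n : ℕ) (hn : n ≠ 0) (Q : ℕ → ℂ → Kˣ) (t : ℕ) :
    ∀ k, k + t = n → ∃ e s : ℤ → ℂ → K,
      HasMonicCoeff (segmentOp n Q k (2 * t + 2)) (2 * t + 2) e ∧ SkewDual (t + 1) s ∧
      ∀ b u, e b u = Qext Q k (u + (t + 1 : ℕ) + k / 2 + halfStep n k) * s b u *
        Qext Q k (u + b + k / 2 - halfStep n k) := by
  induction t with
  | zero =>
    rintro k rfl
    rw [add_zero] at hn ⊢
    set q : ℂ → Kˣ := fun u => Q k (u + k / 2) with hq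
    have hsd : SkewDual 1 (fun b u => if b = 2 then (((q (u + 2))⁻¹ * (q (u + 1))⁻¹ : Kˣ) : K)
        else if b = 0 then -(((q (u + 1))⁻¹ * (q u)⁻¹ : Kˣ) : K) else 0) := by
      intro b u
      rcases eq_or_ne b 2 with rfl | h2
      · simp [show u + 2 - 1 = u + 1 by ring, show u + 1 + 1 = u + 2 by ring]
      rcases eq_or_ne b 0 with rfl | h0
      · simp [show u - 1 + 2 = u + 1 by ring]
      · simp [h2, h0, show 2 - b ≠ 2 by omega, show 2 - b ≠ 0 by omega]
    refine ⟨wrapCoeff (factorCoeff k Q (k + 1)) (factorCoeff k Q (k + 2)) (Pi.single 0 1), _, ?_,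
      hsd, ?_⟩
    · rw [mul_zero, segmentOp_add_two]
      exact hasMonicCoeff_id.wrap _ _
    · intro b u
      simp only [wrapCoeff, Qext, hn, if_false, halfStep, if_true]
      rcases eq_or_ne b 2 with rfl | h2
      · simp [hq, show u + 1 + (k : ℂ) / 2 + 1 = u + 2 + k / 2 by ring,
          show u + 2 + (k : ℂ) / 2 - 1 = u + 1 + k / 2 by ring]
      rcases eq_or_ne b 0 with rfl | h0
      · simp [hq, factorCoeff_mid_mul, show u + 1 + (k : ℂ) / 2 = u + k / 2 + 1 by ring,
          show u + (k : ℂ) / 2 + 1 + 1 = u + k / 2 + 2 by ring]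
        ring
      rcases eq_or_ne b 1 with rfl | h1
      · simp
        linear_combination -factorCoeff_mid_add k Q u
      · simp [h2, h0, show b - 2 ≠ 0 by omega, show b - 1 ≠ 0 by omega]
  | succ t ih =>
    intro k hk
    have hk' : k + 1 + t = n := by omega
    obtain ⟨e, s, he, hs, hes⟩ := ih (k + 1) hk'
    have hkn : halfStep n k = 2⁻¹ := if_neg (by omega)
    obtain ⟨s', hs', hes'⟩ := exists_skewDual_wrapCoeff hs
      (A := fun u => Qext Q (k + 1) (u + (t + 1 : ℕ) + (k + 1 : ℕ) / 2 + halfStep n (k + 1)))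
      (B := fun u => Qext Q (k + 1) (u + (k + 1 : ℕ) / 2 - halfStep n (k + 1)))
      (P := fun u => Ypot n Q (k + 1) (u + (t + 1 : ℕ)) *
        (Qext Q k (u + (t + 1 : ℕ) + (k + 1 : ℕ) / 2))⁻¹)
      (R := fun u => Qext Q k (u + k / 2 - 2⁻¹) * (Ypot n Q (k + 1) u)⁻¹)
      (A' := fun u => Qext Q k (u + (t + 1 + 1 : ℕ) + k / 2 + halfStep n k))
      (B' := fun u => Qext Q k (u + k / 2 - halfStep n k))
      hes
      (fun u => by
        rw [mul_right_comm, Ypot_mul, mul_inv, inv_inv, mul_assoc, mul_comm (Qext Q k _)⁻¹]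
        congr 4
        push_cast
        ring)
      (fun u => by
        push_cast
        rw [hkn, show u + (t + 1 + 1) + (k : ℂ) / 2 + 2⁻¹ = u + 1 + (t + 1) + (k + 1) / 2 by ring,
          show u + (t + 1 : ℂ) + 1 = u + 1 + (t + 1) by ring, mul_inv, inv_inv,
          mul_inv_cancel_right, mul_right_comm, mul_inv_cancel, one_mul])
    refine ⟨_, s', ?_, hs', hes'⟩
    rw [show 2 * (t + 1) + 2 = 2 * t + 2 + 2 by ring, segmentOp_add_two]
    have hp : factorCoeff n Q (k + 1) = fun u => ((Ypot n Q (k + 1) (u + (t + 1 : ℕ)) *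
        (Qext Q k (u + (t + 1 : ℕ) + (k + 1 : ℕ) / 2))⁻¹ *
        (Ypot n Q (k + 1) (u + 1 + (t + 1 : ℕ)) *
        (Qext Q k (u + 1 + (t + 1 : ℕ) + (k + 1 : ℕ) / 2))⁻¹)⁻¹ : Kˣ) : K) := by
      funext u
      rw [factorCoeff_left n Q k t hk', Yq_eq_Ypot, Yq_eq, hkn]
      push_cast
      rw [show u + (t + 1 : ℂ) + (k + 2) / 2 - 2⁻¹ = u + (t + 1) + (k + 1) / 2 by ring,
        show u + (t + 1 : ℂ) + (k + 2) / 2 + 2⁻¹ = u + 1 + (t + 1) + (k + 1) / 2 by ring,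
        show u + (t + 1 : ℂ) + 1 = u + 1 + (t + 1) by ring]
      simp only [mul_inv, inv_inv, Units.val_mul]
      ring
    have hq : factorCoeff n Q (k + (2 * t + 2) + 2) =
        fun u => ((Qext Q k (u + k / 2 - 2⁻¹) * (Ypot n Q (k + 1) u)⁻¹ *
          (Qext Q k (u + 1 + k / 2 - 2⁻¹) * (Ypot n Q (k + 1) (u + 1))⁻¹)⁻¹ : Kˣ) : K) := by
      funext u
      rw [factorCoeff_right n Q k t hk', Yq_eq_Ypot n Q (k + 1), Yq_eq, hkn,
        show u + (k : ℂ) / 2 + 2⁻¹ = u + 1 + k / 2 - 2⁻¹ by ring]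
      simp only [mul_inv, inv_inv, Units.val_mul]
      ring
    rw [hp, hq]
    exact he.wrap _ _

theorem exists_Ljq_coeff (n : ℕ) (hn : n ≠ 0) (Q : ℕ → ℂ → Kˣ) : ∃ e : ℤ → ℂ → K,
    HasMonicCoeff (Ljq n Q (2 * n + 2)) (2 * n + 2) e ∧ SkewDual (n + 1) e := by
  obtain ⟨e, s, he, hs, hes⟩ := exists_segmentOp_coeff n hn Q n 0 (zero_add n)
  have : e = s := by
    funext b u
    simp [hes, Qext]
  rw [Ljq_eq_segmentOp]
  exact ⟨e, he, this ▸ hs⟩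

theorem eq_zpow_mul_of_shift_eq_neg {C : ℂ → K} (hC : ∀ u, C (u + 1) = -C u) (z : ℤ) (u : ℂ) :
    C u = (((-1 : Kˣ) ^ z : Kˣ) : K) * C (u + z) := by
  induction z with
  | zero => simp
  | succ i ih =>
    have := hC (u + i)
    rw [zpow_add_one]
    push_cast at ih ⊢
    rw [← add_assoc, this, ih]
    simp
  | pred i ih =>
    have := hC (u + (-i - 1))
    rw [zpow_sub_one]
    push_cast at ih ⊢
    rw [show u + (-(i : ℂ) - 1) + 1 = u + -i by ring] at this
    rw [ih, this]
    simp

theorem SkewDual.det_toeplitz {r : ℕ} {e : ℤ → ℂ → K} (he : SkewDual r e) (a : ℤ) (m : ℕ) (u : ℂ) :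
    Matrix.det (Matrix.of fun j i : Fin m => e (a + j - i) (u + (i : ℕ))) =
      (-1) ^ m * Matrix.det (Matrix.of fun j i : Fin m =>
        e (2 * r - a + j - i) (u + a - r + (i : ℕ))) := by
  rw [← Matrix.det_transpose (Matrix.of fun j i : Fin m => e (2 * r - a + j - i) _)]
  have h := Matrix.det_neg (Matrix.of fun j i : Fin m =>
    e (2 * r - a + j - i) (u + a - r + (i : ℕ))).transpose
  rw [Fintype.card_fin] at h
  rw [← h]
  congr 1
  ext j i
  simp only [Matrix.of_apply, Matrix.neg_apply, Matrix.transpose_apply, he (a + j - i)]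
  push_cast
  rw [show 2 * (r : ℤ) - (a + j - i) = 2 * r - a + i - j by ring,
    show u + ((i : ℕ) : ℂ) + (a + ((j : ℕ) : ℂ) - ((i : ℕ) : ℂ)) - r = u + a - r + (j : ℕ) by ring]

/-- Duality of Casorati determinants (Lemma 4.1, eq. (4.3)): for the basis of
solutions `w_1, …, w_N` with `L_j(w_m) = 0` and invertible Casoratians,
`ξ^{(a)}_m(u) = (-1)^{a-n-1+m} ξ^{(N-a)}_m(u+a-n-1)` for `0 ≤ a ≤ N`, `m ≥ 0`. -/
theorem statement13 {K : Type*} [CommRing K] (n : ℕ) (hn : 2 ≤ n) (Q : ℕ → ℂ → Kˣ)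
    (w : ℕ → ℂ → K)
    (hw : ∀ m j : ℕ, 1 ≤ m → m ≤ j → j ≤ 2 * n + 2 → Ljq n Q j (w m) = 0)
    (hunit : ∀ (j : ℕ) (u : ℂ), 1 ≤ j → j ≤ 2 * n + 2 → IsUnit (casq w j u))
    (a m : ℕ) (ha : a ≤ 2 * n + 2) (u : ℂ) :
    xiq n w a m u =
      (((-1 : Kˣ) ^ ((a : ℤ) - (n : ℤ) - 1 + (m : ℤ)) : Kˣ) : K) *
        xiq n w (2 * n + 2 - a) m (u + (a : ℂ) - (n : ℂ) - 1) := by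
  obtain ⟨e, he, hdual⟩ := exists_Ljq_coeff n (by omega) Q
  have hrec : ∀ j : ℕ, 1 ≤ j → j ≤ 2 * n + 2 → ∀ u : ℂ,
      ∑ b ∈ range (2 * n + 2 + 1), e b u * w j (u + b) = 0 := by
    intro j h1 h2 u
    rw [← he.apply, hw j _ h1 h2 le_rfl, Pi.zero_apply]
  have hxi : ∀ (a : ℕ), a ≤ 2 * n + 2 → ∀ (m : ℕ) (u : ℂ), xiq n w a m u =
      ((-1) ^ (2 * n + 2 - a)) ^ m * (casq w (2 * n + 2) u *
        Matrix.det (Matrix.of fun j i : Fin m => e ((a : ℤ) + j - i) (u + (i : ℕ)))) :=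
    fun a ha m u => det_gap_casorati (2 * n + 2) w e he.neg he.gt he.top hrec a m ha u
  have hshift : ∀ u, casq w (2 * n + 2) (u + 1) = -casq w (2 * n + 2) u := by
    intro u
    have h := hxi 0 (by omega) 1 u
    have h0 := hdual 0 u
    have htop := he.top
    push_cast at h0 htop
    rw [show 2 * ((n : ℤ) + 1) - 0 = 2 * n + 2 by ring, htop] at h0
    have hx : xiq n w 0 1 u = casq w (2 * n + 2) (u + 1) := by
      unfold xiq casq
      congr 2
      ext j r
      simp only [not_lt_zero, if_false]
      push_cast
      rw [add_assoc, add_comm (1 : ℂ)]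
    rw [← hx, h]
    simp [h0, pow_add, pow_mul]
  rw [hxi a ha, hxi (2 * n + 2 - a) (by omega),
    eq_zpow_mul_of_shift_eq_neg hshift ((a : ℤ) - n - 1) u, hdual.det_toeplitz, zpow_add]
  have hpow : (-1 : K) ^ (2 * n + 2 - (2 * n + 2 - a)) = (-1) ^ (2 * n + 2 - a) :=
    neg_one_pow_congr (by
      rw [Nat.sub_sub_self ha]
      grind)
  rw [hpow, show (2 * ((n + 1 : ℕ) : ℤ) - a : ℤ) = ((2 * n + 2 - a : ℕ) : ℤ) by omega]
  push_cast
  rw [show u + ((a : ℂ) - n - 1) = u + a - n - 1 by ring,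
    show u + (a : ℂ) - (n + 1) = u + a - n - 1 by ring, zpow_natCast]
  push_cast
  ring
end
end

section
/- For every integer m ≥ 0 and every u ∈ ℂ the following two identities hold: ξ^{(n)}_{2m}(u)·ξ^{(n+2)}_{2m}(u−1) = ξ^{(n+1)}_{2m}(u)·ξ^{(n+1)}_{2m}(u−1), and ξ^{(n)}_{2m+1}(u)·ξ^{(n+2)}_{2m+1}(u−1) = −ξ^{(n+1)}_{2m}(u)·ξ^{(n+1)}_{2m+2}(u−1). -/
attribute [local instance 10] Classical.propDecidable

noncomputable section

open Finset

variable {K : Type*} [CommRing K]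

open Matrix in
/-- The three-term Plücker relation for a matrix with two columns replaced. -/
theorem det_updateCol_plucker {ι R : Type*} [Fintype ι] [DecidableEq ι] [CommRing R]
    (M : Matrix ι ι R) {p q : ι} (hpq : p ≠ q) (a b c d : ι → R) :
    ((M.updateCol p a).updateCol q b).det * ((M.updateCol p c).updateCol q d).det =
      ((M.updateCol p c).updateCol q b).det * ((M.updateCol p a).updateCol q d).det +
      ((M.updateCol p a).updateCol q c).det * ((M.updateCol p b).updateCol q d).det := by
  set A := (M.updateCol p a).updateCol q b with hA
  set φ := cramer (M.updateCol q d)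
  have hφ (x : ι → R) : φ x p = ((M.updateCol p x).updateCol q d).det := by
    rw [updateCol_comm _ hpq, cramer_apply]
  have hc : A.det • c = ∑ i, cramer A c i • A.col i := by
    rw [← mulVec_cramer, mulVec_eq_sum]
    simp [Matrix.col_def]
  have key := congrArg (fun x => φ x p) hc
  simp only [map_smul, map_sum, Finset.sum_apply, Pi.smul_apply, smul_eq_mul] at key
  rw [hφ, Finset.sum_eq_add p q hpq] at key
  · rw [key, hφ, hφ, cramer_apply, cramer_apply]
    have hp : A.col p = a := by ext; simp [hA, hpq]
    have hq : A.col q = b := by ext; simp [hA]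
    have hAp : A.updateCol p c = (M.updateCol p c).updateCol q b := by
      rw [hA, updateCol_comm _ hpq.symm, updateCol_idem]
    have hAq : A.updateCol q c = (M.updateCol p a).updateCol q c := by
      rw [hA, updateCol_idem]
    rw [hp, hq, hAp, hAq]
  · rintro i - ⟨hip, hiq⟩
    rw [hφ, det_zero_of_column_eq hip, mul_zero]
    intro k
    simp [hA, hip, hiq, hpq]
  · simp
  · simp

/-- The determinant of the square matrix of size `N` with columns `(c (f r) j)_j`, `r < N`. -/
def colDet (N : ℕ) (c : ℕ → ℕ → K) (f : ℕ → ℕ) : K :=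
  Matrix.det (Matrix.of fun j r : Fin N => c (f r) j)

theorem colDet_congr {N : ℕ} {c : ℕ → ℕ → K} {f g : ℕ → ℕ} (h : ∀ r < N, f r = g r) :
    colDet N c f = colDet N c g := by
  unfold colDet
  congr 1
  ext j r
  simp [h r r.2]

theorem colDet_cycle {N : ℕ} {c : ℕ → ℕ → K} {f g : ℕ → ℕ} {i j : ℕ} (hij : i ≤ j) (hj : j < N)
    (h : ∀ r < N, f r = g (if r < i ∨ j < r then r else if r = j then i else r + 1)) :
    colDet N c f = (-1) ^ (j - i) * colDet N c g := by
  have : NeZero N := ⟨by omega⟩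
  let i' : Fin N := ⟨i, by omega⟩
  let j' : Fin N := ⟨j, hj⟩
  have hij' : i' ≤ j' := hij
  have hdet := Matrix.det_permute' (Fin.cycleIcc i' j')
    (Matrix.of fun k r : Fin N => c (g r) k)
  rw [Fin.sign_cycleIcc_of_le hij'] at hdet
  unfold colDet
  convert hdet using 1
  · congr 1
    ext k r
    simp only [Matrix.of_apply, Matrix.submatrix_apply, id_eq, h r r.2]
    congr 2
    by_cases hri : r < i'
    · rw [Fin.cycleIcc_of_lt hri]
      exact if_pos (Or.inl hri)
    by_cases hjr : j' < r
    · rw [Fin.cycleIcc_of_gt hjr]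
      exact if_pos (Or.inr hjr)
    rw [if_neg (by simpa [Fin.lt_def, i', j'] using And.intro hri hjr),
      Fin.cycleIcc_of_le_of_le (not_lt.1 hri) (not_lt.1 hjr)]
    have hjr' : (r : ℕ) ≤ j := not_lt.1 hjr
    by_cases hrj : r = j'
    · simp [hrj, i', j']
    · have hrj' : (r : ℕ) ≠ j := fun e => hrj (Fin.ext e)
      rw [if_neg hrj', if_neg hrj, Fin.val_add_one_of_lt']
      omega
  · simp [i', j']

theorem colDet_plucker {N : ℕ} (c : ℕ → ℕ → K) (f : ℕ → ℕ) {p q : ℕ} (hp : p < N) (hq : q < N)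
    (hpq : p ≠ q) (x y z t : ℕ) :
    let P (x y : ℕ) := colDet N c fun r => if r = q then y else if r = p then x else f r
    P x y * P z t = P z y * P x t + P x z * P y t := by
  intro P
  have hP (x y : ℕ) : P x y = (((Matrix.of fun j r : Fin N => c (f r) j).updateCol ⟨p, hp⟩
      (fun j => c x j)).updateCol ⟨q, hq⟩ (fun j => c y j)).det := by
    simp only [P, colDet]
    congr 1
    ext j r
    simp only [Matrix.of_apply, Matrix.updateCol_apply, Fin.ext_iff]
    split_ifs <;> rfl
  simp only [hP]
  exact det_updateCol_plucker _ (by simpa using hpq) _ _ _ _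

theorem colDet_swap {N : ℕ} (c : ℕ → ℕ → K) (f : ℕ → ℕ) {p q : ℕ} (hp : p < N) (hq : q < N)
    (hpq : p ≠ q) (x y : ℕ) :
    (colDet N c fun r => if r = q then y else if r = p then x else f r) =
      -colDet N c fun r => if r = q then x else if r = p then y else f r := by
  have hne : (⟨p, hp⟩ : Fin N) ≠ ⟨q, hq⟩ := by simpa using hpq
  have hdet := Matrix.det_permute' (Equiv.swap (⟨p, hp⟩ : Fin N) ⟨q, hq⟩)
    (Matrix.of fun k r : Fin N => c (if r = q then x else if r = p then y else f r) k)
  rw [Equiv.Perm.sign_swap hne] at hdet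
  unfold colDet
  convert hdet using 1
  · congr 1
    ext k r
    simp only [Matrix.of_apply, Matrix.submatrix_apply, id_eq, Equiv.swap_apply_def, Fin.ext_iff]
    grind
  · simp

theorem xiq_eq_colDet (n : ℕ) (w : ℕ → ℂ → K) (a m : ℕ) (u : ℂ) :
    xiq n w a m u = colDet (2 * n + 2) (fun k j => w (j + 1) (u + k))
      fun r => if r < a then r else r + m := rfl

theorem xiq_eq_colDet_sub_one (n : ℕ) (w : ℕ → ℂ → K) (a m : ℕ) (u : ℂ) :
    xiq n w a m u = colDet (2 * n + 2) (fun k j => w (j + 1) (u - 1 + k))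
      fun r => if r < a then r + 1 else r + m + 1 := by
  unfold xiq colDet
  congr 1
  ext j r
  simp only [Matrix.of_apply]
  congr 1
  split_ifs <;> push_cast <;> ring

/-- The three-term bilinear relation among the `ξ^{(a)}_m`, valid without any vanishing
assumption. -/
theorem xiq_mul_xiq_sub_one (n : ℕ) (w : ℕ → ℂ → K) (m : ℕ) (u : ℂ) :
    xiq n w n (m + 1) u * xiq n w (n + 2) (m + 1) (u - 1) =
      xiq n w (n + 1) (m + 1) u * xiq n w (n + 1) (m + 1) (u - 1) -
        xiq n w (n + 1) m u * xiq n w (n + 1) (m + 2) (u - 1) := by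
  set c : ℕ → ℕ → K := fun k j => w (j + 1) (u - 1 + k)
  set f : ℕ → ℕ := fun r => if r ≤ n then r else r + m + 1
  have h0 : 0 < 2 * n + 2 := by omega
  have h1 : n + 1 < 2 * n + 2 := by omega
  let P (x y : ℕ) : K :=
    colDet (2 * n + 2) c fun r => if r = n + 1 then y else if r = 0 then x else f r
  have hswap (x y : ℕ) : P x y = -P y x := colDet_swap c f h0 h1 (by omega) x y
  have key : P 0 (n + 1) * P (n + 2 + m) (2 * n + 3 + m) =
      P (n + 2 + m) (n + 1) * P 0 (2 * n + 3 + m) +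
        P 0 (n + 2 + m) * P (n + 1) (2 * n + 3 + m) :=
    colDet_plucker c f h0 h1 (by omega) _ _ _ _
  rw [hswap (n + 2 + m) (n + 1)] at key
  have hodd : (-1 : K) ^ (2 * n + 1 - 0) = -1 := Odd.neg_one_pow ⟨n, by omega⟩
  have hCE : xiq n w n (m + 1) u = P (n + 2 + m) (2 * n + 3 + m) := by
    rw [hswap, xiq_eq_colDet_sub_one, ← neg_one_mul, ← hodd]
    exact colDet_cycle (by omega) (by omega) fun r hr => by grind
  have hBE : xiq n w (n + 1) (m + 1) u = P (n + 1) (2 * n + 3 + m) := by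
    rw [hswap, xiq_eq_colDet_sub_one, ← neg_one_mul, ← hodd]
    exact colDet_cycle (by omega) (by omega) fun r hr => by grind
  have hAB : xiq n w (n + 2) (m + 1) (u - 1) = P 0 (n + 1) := by
    rw [xiq_eq_colDet]
    exact colDet_congr fun r hr => by grind
  have hAC : xiq n w (n + 1) (m + 1) (u - 1) = P 0 (n + 2 + m) := by
    rw [xiq_eq_colDet]
    exact colDet_congr fun r hr => by grind
  have hBC : xiq n w (n + 1) m u = (-1) ^ n * P (n + 1) (n + 2 + m) := by
    rw [xiq_eq_colDet_sub_one]
    exact colDet_cycle (i := 0) (by omega) (by omega) fun r hr => by grind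
  have hAE : xiq n w (n + 1) (m + 2) (u - 1) = (-1) ^ n * P 0 (2 * n + 3 + m) := by
    have hexp : 2 * n + 1 - (n + 1) = n := by omega
    rw [xiq_eq_colDet, ← congrArg ((-1 : K) ^ ·) hexp]
    exact colDet_cycle (by omega) (by omega) fun r hr => by grind
  have hsq : ((-1 : K) ^ n) * (-1) ^ n = 1 := by rw [← mul_pow]; simp
  rw [hCE, hBE, hAB, hAC, hBC, hAE]
  linear_combination key + P (n + 1) (n + 2 + m) * P 0 (2 * n + 3 + m) * hsq

/-- The identities (2.31): assuming `ξ^{(n+1)}_{2k+1} = 0`,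
`ξ^{(n)}_{2m}(u) ξ^{(n+2)}_{2m}(u-1) = ξ^{(n+1)}_{2m}(u) ξ^{(n+1)}_{2m}(u-1)` and
`ξ^{(n)}_{2m+1}(u) ξ^{(n+2)}_{2m+1}(u-1) = -ξ^{(n+1)}_{2m}(u) ξ^{(n+1)}_{2m+2}(u-1)`. -/
theorem statement15 {K : Type*} [CommRing K] (n : ℕ) (hn : 2 ≤ n) (w : ℕ → ℂ → K)
    (hodd : ∀ (k : ℕ) (u : ℂ), xiq n w (n + 1) (2 * k + 1) u = 0)
    (m : ℕ) (u : ℂ) :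
    xiq n w n (2 * m) u * xiq n w (n + 2) (2 * m) (u - 1) =
      xiq n w (n + 1) (2 * m) u * xiq n w (n + 1) (2 * m) (u - 1) ∧
    xiq n w n (2 * m + 1) u * xiq n w (n + 2) (2 * m + 1) (u - 1) =
      -(xiq n w (n + 1) (2 * m) u * xiq n w (n + 1) (2 * m + 2) (u - 1)) := by
  refine ⟨?_, ?_⟩
  · rcases m with _ | m
    · simp only [xiq_eq_colDet, mul_zero, add_zero, ite_self]
    · rw [show 2 * (m + 1) = 2 * m + 1 + 1 by ring, xiq_mul_xiq_sub_one, hodd]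
      ring
  · rw [xiq_mul_xiq_sub_one, hodd]
    ring
end
end

section
/- Let (i_1 ≺ i_2 ≺ ⋯ ≺ i_a) be a strictly increasing tableau with entries in J. Call a pair of positions k < l with i_k = q and i_l = q̄ (for some 1 ≤ q ≤ n) a breaking pair if n + k − l < q, and call it a maximal breaking pair if moreover q ≥ r for every breaking pair of positions k' < l' with i_{k'} = r, i_{l'} = r̄. If positions k < l with i_k = q, i_l = q̄ form a maximal breaking pair, then the number of entries strictly between them equals n − q, i.e. l − k − 1 = n − q. -/
/-- If no pair of positions carrying letters `r, r̄` with `r > q` is breaking, then a window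
`[K, L)` of positions whose entries lie among the `2d` middle letters of `J`, with `q + d ≤ n`,
has at most `d` positions. -/
theorem window_length_le_of_no_breaking {n a : ℕ} {t : Fin a → Fin (2 * n)} (ht : StrictMono t)
    {q : ℕ}
    (hmax : ∀ (k' l' : Fin a) (r : ℕ), k' < l' → 1 ≤ r → r ≤ n →
      (t k' : ℕ) + 1 = r → (t l' : ℕ) + 1 = 2 * n + 1 - r →
      (n : ℤ) + ((k' : ℕ) : ℤ) - ((l' : ℕ) : ℤ) < (r : ℤ) → r ≤ q)
    (d : ℕ) (hd : q + d ≤ n) (K L : ℕ) (hL : L ≤ a)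
    (hw : ∀ x : Fin a, K ≤ x → (x : ℕ) < L → n ≤ t x + d ∧ (t x : ℕ) < n + d) :
    L ≤ K + d := by
  induction d generalizing K L with
  | zero =>
    by_contra! h
    have := hw ⟨K, by omega⟩ le_rfl (by simpa using h)
    omega
  | succ d ih =>
    by_contra! h
    have hfirst := hw ⟨K, by omega⟩ le_rfl (by simp only; omega)
    have hlast := hw ⟨L - 1, by omega⟩ (by simp only; omega) (by simp only; omega)
    have hgt (x : Fin a) (hx : K < x) : t ⟨K, by omega⟩ < t x := ht hx
    have hlt (x : Fin a) (hx : (x : ℕ) < L - 1) : t x < t ⟨L - 1, by omega⟩ := ht hx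
    simp only [Fin.lt_def] at hgt hlt
    by_cases h1 : (t ⟨K, by omega⟩ : ℕ) + d + 1 = n
    · by_cases h2 : (t ⟨L - 1, by omega⟩ : ℕ) = n + d
      · have hinner := ih (by omega) (K + 1) (L - 1) (by omega) fun x hx hx' => by
          have := hgt x (by omega)
          have := hlt x hx'
          omega
        have := hmax ⟨K, by omega⟩ ⟨L - 1, by omega⟩ (n - d) (by simp only [Fin.lt_def]; omega)
          (by omega) (by omega) (by omega) (by omega) (by simp only; omega)
        omega
      · have := ih (by omega) (K + 1) L hL fun x hx hx' => by
          have := hgt x hx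
          have : (t x : ℕ) ≤ t ⟨L - 1, by omega⟩ := ht.monotone (Fin.le_def.2 (by simp only; omega))
          omega
        omega
    · have := ih (by omega) K (L - 1) (by omega) fun x hx hx' => by
        have : (t ⟨K, by omega⟩ : ℕ) ≤ t x := ht.monotone (Fin.le_def.2 hx)
        have := hlt x hx'
        omega
      omega


/-- Lemma A.7: in a strictly increasing tableau with entries in
`J = {1 ≺ ⋯ ≺ n ≺ n̄ ≺ ⋯ ≺ 1̄}` (encoded as `Fin (2n)`, the letter `c` being
`c - 1` and the letter `c̄` being `2n - c`), if the positions `k < l` carrying the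
letters `q, q̄` form a maximal breaking pair (a pair is breaking if `n + k - l < q`,
and maximal if its letter is largest among the breaking pairs), then the number of
entries strictly between them is `n - q`, i.e. `l - k - 1 = n - q`. -/
theorem statement17 (n a : ℕ) (hn : 2 ≤ n) (t : Fin a → Fin (2 * n))
    (ht : StrictMono t) (k l : Fin a) (hkl : k < l) (q : ℕ) (hq1 : 1 ≤ q) (hqn : q ≤ n)
    (hk : (t k : ℕ) + 1 = q) (hl : (t l : ℕ) + 1 = 2 * n + 1 - q)
    (hbreak : (n : ℤ) + ((k : ℕ) : ℤ) - ((l : ℕ) : ℤ) < (q : ℤ))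
    (hmax : ∀ (k' l' : Fin a) (r : ℕ), k' < l' → 1 ≤ r → r ≤ n →
      (t k' : ℕ) + 1 = r → (t l' : ℕ) + 1 = 2 * n + 1 - r →
      (n : ℤ) + ((k' : ℕ) : ℤ) - ((l' : ℕ) : ℤ) < (r : ℤ) → r ≤ q) :
    ((l : ℕ) : ℤ) - ((k : ℕ) : ℤ) - 1 = (n : ℤ) - (q : ℤ) := by
  have hwindow := window_length_le_of_no_breaking ht hmax (n - q) (by omega) (k + 1) l l.2.le
    fun x hx hx' => by
      have h1 : t k < t x := ht (Fin.lt_def.2 (by omega))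
      have h2 : t x < t l := ht (Fin.lt_def.2 (by omega))
      rw [Fin.lt_def] at h1 h2
      omega
  omega
end
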